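/- For each integer n ≥ 2, let λ^(n) be a random vector uniformly distributed on the scaled simplex 𝕊^n = { λ ∈ ℝ_{≥0}^n : Σ_{j=0}^{n−1} λ_j = n }, and let U^(n) be a random n×n orthogonal matrix distributed according to the Haar probability measure on the orthogonal group O(n), independent of λ^(n). Set Σ^ko,n = U^(n) · diag(λ^(n)_0, …, λ^(n)_{n−1}) · (U^(n))^T. Then Σ^ko,n converges to the identity in probability as n → ∞: for every ε > 0, lim_{n→∞} P( max_{0 ≤ j,k ≤ n−1} | (Σ^ko,n)_{j,k} − (I_n)_{j,k} | > ε ) = 0. -/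

import Mathlib

open MeasureTheory ProbabilityTheory Matrix

/-- The (entrywise) Borel measurable structure on real matrices. -/
instance matrixMeasurableSpace (n : ℕ) :
    MeasurableSpace (Matrix (Fin n) (Fin n) ℝ) :=
  MeasurableSpace.pi

/-- The parametrization of the scaled simplex
`𝕊^n = {λ ∈ ℝ_{≥0}^n : Σ_j λ_j = n}` by its first `n−1` coordinates:
`λ_j = p_j` for `j < n−1` and `λ_{n−1} = n − Σ_{j<n−1} p_j`. -/
noncomputable def simplexParam (n : ℕ) (p : Fin (n - 1) → ℝ) : Fin n → ℝ :=
  fun j => if h : (j : ℕ) < n - 1 then p ⟨j, h⟩ else (n : ℝ) - ∑ i, p i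

/-- The uniform probability distribution on the scaled simplex `𝕊^n`: the image
under `simplexParam n` of the normalized Lebesgue measure on
`T = {p ∈ ℝ^{n−1} : p_j ≥ 0, Σ p_j ≤ n}`. -/
noncomputable def simplexUniform (n : ℕ) : Measure (Fin n → ℝ) :=
  Measure.map (simplexParam n)
    ((volume {p : Fin (n - 1) → ℝ | (∀ j, 0 ≤ p j) ∧ ∑ j, p j ≤ (n : ℝ)})⁻¹ •
      volume.restrict {p : Fin (n - 1) → ℝ | (∀ j, 0 ≤ p j) ∧ ∑ j, p j ≤ (n : ℝ)})

namespace KO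

noncomputable def sgn (b : Bool) : ℝ := if b then 1 else -1

lemma sgn_sq (b : Bool) : sgn b * sgn b = 1 := by cases b <;> simp [sgn]

/-- Expectation over uniformly random signs. -/
noncomputable def E (n : ℕ) (f : (Fin n → Bool) → ℝ) : ℝ := (∑ s, f s) / 2 ^ n

lemma E_zero (f : (Fin 0 → Bool) → ℝ) : E 0 f = f Fin.elim0 := by
  unfold E
  rw [Fintype.sum_eq_single (Fin.elim0 : Fin 0 → Bool)]
  · simp
  · intro x hx; exact absurd (Subsingleton.elim _ _) hx

lemma E_succ (n : ℕ) (f : (Fin (n + 1) → Bool) → ℝ) :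
    E (n + 1) f = E n (fun y => (f (Fin.cons true y) + f (Fin.cons false y)) / 2) := by
  unfold E
  rw [← (Fin.consEquiv (fun _ : Fin (n + 1) => Bool)).sum_comp, Fintype.sum_prod_type]
  simp only [Fintype.sum_bool]
  rw [← Finset.sum_add_distrib, ← Finset.sum_div, pow_succ]
  field_simp
  rfl

lemma E_add (n : ℕ) (f g : (Fin n → Bool) → ℝ) :
    E n (fun s => f s + g s) = E n f + E n g := by
  unfold E; rw [Finset.sum_add_distrib, add_div]

lemma E_mul_left (n : ℕ) (c : ℝ) (f : (Fin n → Bool) → ℝ) :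
    E n (fun s => c * f s) = c * E n f := by
  unfold E; rw [← Finset.mul_sum, mul_div_assoc]

lemma E_nonneg (n : ℕ) (f : (Fin n → Bool) → ℝ) (h : ∀ s, 0 ≤ f s) : 0 ≤ E n f := by
  unfold E; exact div_nonneg (Finset.sum_nonneg fun s _ => h s) (by positivity)

lemma E_cs (n : ℕ) (f g : (Fin n → Bool) → ℝ) :
    (E n (fun s => f s * g s)) ^ 2 ≤ E n (fun s => f s ^ 2) * E n (fun s => g s ^ 2) := by
  unfold E
  rw [div_pow, div_mul_div_comm, ← sq]
  gcongr
  exact Finset.sum_mul_sq_le_sq_mul_sq _ _ _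

/-- `Deg n d f`: `f` is a polynomial in the signs of degree `< d`. -/
def Deg : (n : ℕ) → ℕ → ((Fin n → Bool) → ℝ) → Prop
  | _, 0, f => ∀ s, f s = 0
  | 0, _ + 1, _ => True
  | n + 1, d + 1, f => ∃ g h, Deg n d g ∧ Deg n (d + 1) h ∧
      ∀ b y, f (Fin.cons b y) = sgn b * g y + h y

lemma deg_n0 {n : ℕ} {f : (Fin n → Bool) → ℝ} : Deg n 0 f ↔ ∀ s, f s = 0 := by
  cases n <;> simp [Deg]

lemma deg_zero (n d : ℕ) (f : (Fin n → Bool) → ℝ) (hf : ∀ s, f s = 0) : Deg n d f := by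
  induction n generalizing d with
  | zero => cases d <;> simp [Deg, hf]
  | succ n ih =>
    cases d with
    | zero => exact deg_n0.2 hf
    | succ d => exact ⟨fun _ => 0, fun _ => 0, ih _ _ (by simp), ih _ _ (by simp), by simp [hf]⟩

lemma deg_succ (n d : ℕ) (f : (Fin n → Bool) → ℝ) (hf : Deg n d f) : Deg n (d + 1) f := by
  induction n generalizing d with
  | zero => simp [Deg]
  | succ n ih =>
    cases d with
    | zero => exact deg_zero _ _ _ (deg_n0.1 hf)
    | succ d =>
      obtain ⟨g, h, hg, hh, e⟩ := hf
      exact ⟨g, h, ih _ _ hg, ih _ _ hh, e⟩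

lemma deg_add (n d : ℕ) (f f' : (Fin n → Bool) → ℝ) (hf : Deg n d f) (hf' : Deg n d f') :
    Deg n d (fun s => f s + f' s) := by
  induction n generalizing d with
  | zero =>
    cases d with
    | zero => rw [deg_n0] at *; simp_all
    | succ d => simp [Deg]
  | succ n ih =>
    cases d with
    | zero => rw [deg_n0] at *; simp_all
    | succ d =>
      obtain ⟨g, h, hg, hh, e⟩ := hf
      obtain ⟨g', h', hg', hh', e'⟩ := hf'
      refine ⟨_, _, ih _ _ _ hg hg', ih _ _ _ hh hh', fun b y => ?_⟩
      simp only [e, e']; ring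

lemma deg_mul (n d d' : ℕ) (f f' : (Fin n → Bool) → ℝ) (hf : Deg n d f) (hf' : Deg n d' f') :
    Deg n (d + d') (fun s => f s * f' s) := by
  induction n generalizing d d' with
  | zero =>
    rcases d with _ | d
    · exact deg_zero _ _ _ (by rw [deg_n0] at hf; simp [hf])
    · rw [show d + 1 + d' = (d + d') + 1 by ring]; simp [Deg]
  | succ n ih =>
    rcases d with _ | d
    · exact deg_zero _ _ _ (by rw [deg_n0] at hf; simp [hf])
    rcases d' with _ | d'
    · exact deg_zero _ _ _ (by rw [deg_n0] at hf'; simp [hf'])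
    obtain ⟨g, h, hg, hh, e⟩ := hf
    obtain ⟨g', h', hg', hh', e'⟩ := hf'
    rw [show d + 1 + (d' + 1) = (d + d' + 1) + 1 by ring]
    have h1 : Deg n (d + d' + 1) (fun s => g s * h' s) := by
      have := ih _ _ _ _ hg hh'
      rwa [← add_assoc] at this
    have h2 : Deg n (d + d' + 1) (fun s => h s * g' s) := by
      have := ih _ _ _ _ hh hg'
      rwa [add_right_comm] at this
    have h3 : Deg n (d + d' + 1 + 1) (fun s => h s * h' s) := by
      have := ih _ _ _ _ hh hh'
      rwa [show d + 1 + (d' + 1) = (d + d' + 1) + 1 by ring] at this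
    have h4 : Deg n (d + d' + 1 + 1) (fun s => g s * g' s) :=
      deg_succ _ _ _ (deg_succ _ _ _ (ih _ _ _ _ hg hg'))
    refine ⟨_, _, deg_add _ _ _ _ h1 h2, deg_add _ _ _ _ h4 h3, fun b y => ?_⟩
    simp only [e, e']
    linear_combination (g y * g' y) * sgn_sq b

lemma deg_const (n : ℕ) (c : ℝ) : Deg n 1 (fun _ => c) := by
  induction n with
  | zero => simp [Deg]
  | succ n ih => exact ⟨fun _ => 0, _, deg_zero _ _ _ (by simp), ih, by simp⟩

lemma deg_coord (n : ℕ) (i : Fin n) : Deg n 2 (fun s => sgn (s i)) := by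
  induction n with
  | zero => exact i.elim0
  | succ n ih =>
    refine Fin.cases ?_ (fun i => ?_) i
    · exact ⟨fun _ => 1, fun _ => 0, deg_const _ _, deg_zero _ _ _ (by simp), by simp⟩
    · exact ⟨fun _ => 0, _, deg_zero _ _ _ (by simp), ih i, by simp⟩

lemma deg_sum {ι : Type*} (t : Finset ι) (n d : ℕ) (f : ι → (Fin n → Bool) → ℝ)
    (hf : ∀ i, Deg n d (f i)) : Deg n d (fun s => ∑ i ∈ t, f i s) := by
  classical
  induction t using Finset.induction_on with
  | empty => exact deg_zero _ _ _ (by simp)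
  | insert a t ha ih =>
    simp only [Finset.sum_insert ha]
    exact deg_add _ _ _ _ (hf a) ih

lemma bonami (n d : ℕ) (f : (Fin n → Bool) → ℝ) (hf : Deg n d f) :
    E n (fun s => f s ^ 4) ≤ 9 ^ d * (E n (fun s => f s ^ 2)) ^ 2 := by
  induction n generalizing d with
  | zero =>
    simp only [E_zero]
    have : (1 : ℝ) ≤ 9 ^ d := one_le_pow₀ (by norm_num)
    nlinarith [sq_nonneg (f Fin.elim0 ^ 2)]
  | succ n ih =>
    rcases d with _ | d
    · rw [deg_n0] at hf
      simp [hf, E]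
    obtain ⟨g, h, hg, hh, e⟩ := hf
    have e4 : E (n + 1) (fun s => f s ^ 4) = E n (fun s => g s ^ 4) +
        6 * E n (fun s => g s ^ 2 * h s ^ 2) + E n (fun s => h s ^ 4) := by
      rw [E_succ, ← E_mul_left, ← E_add, ← E_add]
      congr 1; ext y; rw [e, e]; simp [sgn]; ring
    have e2 : E (n + 1) (fun s => f s ^ 2) = E n (fun s => g s ^ 2) + E n (fun s => h s ^ 2) := by
      rw [E_succ, ← E_add]
      congr 1; ext y; rw [e, e]; simp [sgn]; ring
    have hg4 := ih _ _ hg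
    have hh4 := ih _ _ hh
    have cs := E_cs n (fun s => g s ^ 2) (fun s => h s ^ 2)
    simp only [← pow_mul] at cs
    norm_num at cs
    rw [e4, e2]
    have G0 := E_nonneg n (fun s => g s ^ 2) (fun s => by positivity)
    have H0 := E_nonneg n (fun s => h s ^ 2) (fun s => by positivity)
    have H4 := E_nonneg n (fun s => h s ^ 4) (fun s => by positivity)
    set G := E n (fun s => g s ^ 2)
    set H := E n (fun s => h s ^ 2)
    set G4 := E n (fun s => g s ^ 4)
    set K4 := E n (fun s => h s ^ 4)
    set X := E n (fun s => g s ^ 2 * h s ^ 2)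
    rw [pow_succ (9:ℝ) d] at *
    set a : ℝ := 9 ^ d
    have ha : 0 ≤ a := by positivity
    have hX : X ≤ 3 * a * G * H := by
      apply le_of_sq_le_sq _ (by positivity)
      calc X ^ 2 ≤ G4 * K4 := cs
        _ ≤ (a * G ^ 2) * (a * 9 * H ^ 2) := by gcongr
        _ = _ := by ring
    nlinarith [mul_nonneg ha (sq_nonneg G)]

lemma lin_second (n : ℕ) (b : Fin n → ℝ) (c : ℝ) :
    E n (fun s => (c + ∑ i, b i * sgn (s i)) ^ 2) = c ^ 2 + ∑ i, b i ^ 2 := by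
  induction n generalizing c with
  | zero => simp [E_zero]
  | succ n ih =>
    rw [E_succ]
    simp only [Fin.sum_univ_succ, Fin.cons_zero, Fin.cons_succ]
    have : ∀ y : Fin n → Bool, ((c + (b 0 * sgn true + ∑ i : Fin n, b i.succ * sgn (y i))) ^ 2 +
        (c + (b 0 * sgn false + ∑ i : Fin n, b i.succ * sgn (y i))) ^ 2) / 2
        = b 0 ^ 2 * 1 + (c + ∑ i : Fin n, b i.succ * sgn (y i)) ^ 2 := by
      intro y; simp [sgn]; ring
    simp only [this]
    rw [E_add, ih, E_mul_left]
    simp [E]; ring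

lemma quad_second (n : ℕ) (A : Fin n → Fin n → ℝ) (c : ℝ) :
    E n (fun s => (c + ∑ i, ∑ j, A i j * sgn (s i) * sgn (s j)) ^ 2) ≤
      (c + ∑ i, A i i) ^ 2 + 2 * ∑ i, ∑ j, A i j ^ 2 := by
  induction n generalizing c with
  | zero => simp [E_zero]
  | succ n ih =>
    rw [E_succ]
    have key : ∀ y : Fin n → Bool,
        ((c + ∑ i, ∑ j, A i j * sgn ((Fin.cons true y : Fin (n+1) → Bool) i)
              * sgn ((Fin.cons true y : Fin (n+1) → Bool) j)) ^ 2 +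
        (c + ∑ i, ∑ j, A i j * sgn ((Fin.cons false y : Fin (n+1) → Bool) i)
              * sgn ((Fin.cons false y : Fin (n+1) → Bool) j)) ^ 2) / 2
        = (0 + ∑ i : Fin n, (A 0 i.succ + A i.succ 0) * sgn (y i)) ^ 2 +
          ((c + A 0 0) + ∑ i : Fin n, ∑ j : Fin n, A i.succ j.succ * sgn (y i) * sgn (y j)) ^ 2 := by
      intro y
      simp only [Fin.sum_univ_succ, Fin.cons_zero, Fin.cons_succ, Finset.sum_add_distrib, add_mul,
        sgn]
      simp only [if_true, Bool.false_eq_true, if_false, mul_one, mul_neg, neg_mul,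
        Finset.sum_neg_distrib]
      ring
    simp only [key]
    rw [E_add, lin_second]
    have := ih (fun i j => A i.succ j.succ) (c + A 0 0)
    have h2 : ∑ i : Fin n, (A 0 i.succ + A i.succ 0) ^ 2 ≤
        2 * ∑ i : Fin n, A 0 i.succ ^ 2 + 2 * ∑ i : Fin n, A i.succ 0 ^ 2 := by
      rw [Finset.mul_sum, Finset.mul_sum, ← Finset.sum_add_distrib]
      gcongr with i
      nlinarith [sq_nonneg (A 0 i.succ - A i.succ 0)]
    simp only [Fin.sum_univ_succ, Finset.sum_add_distrib]
    nlinarith [sq_nonneg (A 0 0)]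

lemma quad_eighth (n : ℕ) (A : Fin n → Fin n → ℝ) (h0 : ∑ i, A i i = 0) (R : ℝ)
    (hR : ∑ i, ∑ j, A i j ^ 2 ≤ R) :
    E n (fun s => (∑ i, ∑ j, A i j * sgn (s i) * sgn (s j)) ^ 8) ≤ 9 ^ 30 * (2 * R) ^ 4 := by
  set f : (Fin n → Bool) → ℝ := fun s => ∑ i, ∑ j, A i j * sgn (s i) * sgn (s j) with hf
  have hd : Deg n 5 f := deg_sum _ _ _ _ fun i => deg_sum _ _ _ _ fun j =>
    deg_mul _ 3 2 _ _ (deg_mul _ 1 2 _ _ (deg_const _ _) (deg_coord _ i)) (deg_coord _ j)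
  have h4 := bonami _ _ _ hd
  have h8 := bonami _ _ _ (deg_mul _ _ _ _ _ hd hd)
  have h2 := quad_second n A 0
  simp only [zero_add, h0] at h2
  have e8 : (fun s => (f s * f s) ^ 4) = fun s => f s ^ 8 := by ext; ring
  have e4 : (fun s => (f s * f s) ^ 2) = fun s => f s ^ 4 := by ext; ring
  rw [e8, e4] at h8
  have p2 : 0 ≤ E n (fun s => f s ^ 2) := E_nonneg _ _ fun s => by positivity
  have p4 : 0 ≤ E n (fun s => f s ^ 4) := E_nonneg _ _ fun s => by positivity
  have h2' : E n (fun s => f s ^ 2) ≤ 2 * R := by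
    refine h2.trans ?_
    linarith
  calc _ ≤ (9:ℝ) ^ (5 + 5) * E n (fun s => f s ^ 4) ^ 2 := h8
    _ ≤ (9:ℝ) ^ (5 + 5) * (9 ^ 5 * (2 * R) ^ 2) ^ 2 := by
      gcongr
      exact h4.trans (by gcongr)
    _ = 9 ^ 20 * (2 * R) ^ 4 := by ring
    _ ≤ _ := by gcongr <;> norm_num


def T (m : ℕ) (s : ℝ) : Set (Fin m → ℝ) := {p | (∀ j, 0 ≤ p j) ∧ ∑ j, p j ≤ s}

lemma measurableSet_T (m : ℕ) (s : ℝ) : MeasurableSet (T m s) := by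
  unfold T
  measurability

open Pointwise in
lemma volume_T_scale (m : ℕ) (s r : ℝ) (hr : 0 < r) :
    volume (T m (r * s)) = ENNReal.ofReal (r ^ m) * volume (T m s) := by
  have : T m (r * s) = r • T m s := by
    ext p
    rw [Set.mem_smul_set_iff_inv_smul_mem₀ hr.ne']
    simp only [T, Set.mem_ofPred_eq, Pi.smul_apply, smul_eq_mul, ← Finset.mul_sum]
    rw [inv_mul_le_iff₀ hr]
    simp [hr]
  rw [this, Measure.addHaar_smul, abs_of_pos (by positivity)]
  simp

lemma measurable_simplexParam (n : ℕ) : Measurable (simplexParam n) := by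
  rw [measurable_pi_iff]
  intro j
  unfold simplexParam
  split_ifs <;> fun_prop

lemma simplex_tail (n : ℕ) (t : ℝ) (h0 : 0 ≤ t) (ht : t < n) (i : Fin n) :
    simplexUniform n {l | t < l i} ≤ ENNReal.ofReal ((1 - t / n) ^ (n - 1)) := by
  have hn : (0 : ℝ) < n := h0.trans_lt ht
  unfold simplexUniform
  rw [Measure.map_apply (measurable_simplexParam n)
    (measurableSet_lt measurable_const (measurable_pi_apply i))]
  change ((volume (T (n-1) n))⁻¹ • volume.restrict (T (n-1) n)) _ ≤ _
  rw [Measure.smul_apply, Measure.restrict_apply' (measurableSet_T _ _)]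
  have key : volume (simplexParam n ⁻¹' {l | t < l i} ∩ T (n - 1) n) ≤
      volume (T (n - 1) (n - t)) := by
    by_cases hi : (i : ℕ) < n - 1
    · rw [← measure_preimage_add_right volume (Pi.single ⟨i, hi⟩ (-t)) (T (n - 1) (n - t))]
      apply measure_mono
      rintro p ⟨hp1, hp2, hp3⟩
      simp only [simplexParam, Set.mem_preimage, Set.mem_ofPred_eq, hi, dif_pos] at hp1
      refine ⟨fun j => ?_, ?_⟩
      · by_cases hj : j = ⟨i, hi⟩
        · subst hj; simp; linarith
        · simp [hj, hp2 j]
      · simp only [Pi.add_apply, Finset.sum_add_distrib, Finset.sum_pi_single', Finset.mem_univ,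
          if_true]
        have : ∑ x, (Pi.single (⟨i, hi⟩ : Fin (n-1)) (-t) : Fin (n-1) → ℝ) x = -t := by simp
        linarith
    · apply measure_mono
      rintro p ⟨hp1, hp2, hp3⟩
      simp only [simplexParam, Set.mem_preimage, Set.mem_ofPred_eq, hi] at hp1
      refine ⟨hp2, ?_⟩
      simp at hp1
      linarith
  have hr : 0 < 1 - t / n := by rw [sub_pos, div_lt_one hn]; exact ht
  have e : (n : ℝ) - t = (1 - t / n) * n := by field_simp
  rw [e, volume_T_scale _ _ _ hr] at key
  calc _ ≤ (volume (T (n-1) n))⁻¹ * (ENNReal.ofReal ((1 - t / n) ^ (n-1)) * volume (T (n-1) n)) := by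
        rw [smul_eq_mul]; gcongr
    _ = ENNReal.ofReal ((1 - t / n) ^ (n-1)) * ((volume (T (n-1) n))⁻¹ * volume (T (n-1) n)) := by
        ring
    _ ≤ ENNReal.ofReal ((1 - t / n) ^ (n-1)) * 1 := by
        gcongr; exact ENNReal.inv_mul_le_one _
    _ = _ := mul_one _

lemma simplex_supp (n : ℕ) (hn : 1 ≤ n) :
    simplexUniform n {l | ¬ ((∀ i, 0 ≤ l i) ∧ ∑ i, l i = n)} = 0 := by
  unfold simplexUniform
  rw [Measure.map_apply (measurable_simplexParam n) (by measurability)]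
  change ((volume (T (n-1) n))⁻¹ • volume.restrict (T (n-1) n)) _ = _
  rw [Measure.smul_apply, Measure.restrict_apply' (measurableSet_T _ _)]
  have : simplexParam n ⁻¹' {l | ¬ ((∀ i, 0 ≤ l i) ∧ ∑ i, l i = n)} ∩ T (n - 1) n = ∅ := by
    rw [Set.eq_empty_iff_forall_notMem]
    rintro p ⟨hp1, hp2, hp3⟩
    apply hp1
    refine ⟨fun i => ?_, ?_⟩
    · unfold simplexParam
      split_ifs with h
      · exact hp2 _
      · linarith
    · obtain ⟨m, rfl⟩ : ∃ m, n = m + 1 := ⟨n - 1, by omega⟩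
      rw [Fin.sum_univ_castSucc]
      simp [simplexParam]
  rw [this]; simp

lemma simplex_max (n : ℕ) (hn : 2 ≤ n) (t : ℝ) (h0 : 0 ≤ t) (ht : t < n) :
    simplexUniform n {l | ¬ (((∀ i, 0 ≤ l i) ∧ ∑ i, l i = n) ∧ ∀ i, l i ≤ t)} ≤
      ENNReal.ofReal (n * Real.exp (- t / 2)) := by
  have hn' : (2 : ℝ) ≤ n := by exact_mod_cast hn
  have sub : {l : Fin n → ℝ | ¬ (((∀ i, 0 ≤ l i) ∧ ∑ i, l i = n) ∧ ∀ i, l i ≤ t)} ⊆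
      {l | ¬ ((∀ i, 0 ≤ l i) ∧ ∑ i, l i = n)} ∪ ⋃ i, {l | t < l i} := by
    intro l hl
    by_contra h
    simp only [Set.mem_union, Set.mem_iUnion, Set.mem_ofPred_eq, not_or, not_not, not_exists,
      not_lt] at h
    exact hl h
  have hr : 0 ≤ 1 - t / n := by rw [sub_nonneg, div_le_one (by linarith)]; exact ht.le
  have hb : (1 - t / n) ^ (n - 1) ≤ Real.exp (- t / 2) := by
    calc (1 - t / n) ^ (n - 1) ≤ (Real.exp (-(t / n))) ^ (n - 1) := by
          gcongr; linarith [Real.add_one_le_exp (-(t/n))]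
      _ = Real.exp (((n - 1 : ℕ) : ℝ) * -(t / n)) := by rw [← Real.exp_nat_mul]
      _ ≤ _ := by
        apply Real.exp_le_exp.2
        rw [Nat.cast_sub (by omega)]
        have : t / 2 ≤ (n - 1) * (t / n) := by
          rw [mul_div_assoc', div_le_div_iff₀ (by norm_num) (by linarith)]
          nlinarith
        push_cast
        linarith
  calc _ ≤ _ := measure_mono sub
    _ ≤ _ := measure_union_le _ _
    _ ≤ 0 + ∑ i : Fin n, simplexUniform n {l | t < l i} := by
      rw [simplex_supp n (by omega)]
      gcongr; exact measure_iUnion_fintype_le _ _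
    _ ≤ ∑ i : Fin n, ENNReal.ofReal (Real.exp (- t / 2)) := by
      rw [zero_add]
      gcongr with i
      exact (simplex_tail n t h0 ht i).trans (ENNReal.ofReal_le_ofReal hb)
    _ = _ := by
      rw [Finset.sum_const, ENNReal.ofReal_mul (by positivity)]
      simp

/-- The centered random matrix. -/
noncomputable def M {n : ℕ} (u : Matrix (Fin n) (Fin n) ℝ) (l : Fin n → ℝ) :
    Matrix (Fin n) (Fin n) ℝ := u * Matrix.diagonal l * uᵀ - 1

lemma M_apply {n : ℕ} (u : Matrix (Fin n) (Fin n) ℝ) (l : Fin n → ℝ) (i j : Fin n) :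
    M u l i j = ∑ k, u i k * l k * u j k - (1 : Matrix (Fin n) (Fin n) ℝ) i j := by
  rw [M, Matrix.sub_apply, Matrix.mul_apply]
  simp only [Matrix.mul_diagonal, Matrix.transpose_apply]

lemma M_eq {n : ℕ} (u : Matrix (Fin n) (Fin n) ℝ) (l : Fin n → ℝ) (hu : u * uᵀ = 1) :
    M u l = u * Matrix.diagonal (fun i => l i - 1) * uᵀ := by
  have : Matrix.diagonal (fun i => l i - 1) = Matrix.diagonal l - 1 := by
    rw [← Matrix.diagonal_one, Matrix.diagonal_sub]
  rw [this, Matrix.mul_sub, Matrix.sub_mul, Matrix.mul_one, hu, M]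

lemma M_trace {n : ℕ} (u : Matrix (Fin n) (Fin n) ℝ) (l : Fin n → ℝ) (hu : u * uᵀ = 1)
    (hl : ∑ i, l i = n) : ∑ i, M u l i i = 0 := by
  have hu' : uᵀ * u = 1 := mul_eq_one_comm.1 hu
  change (M u l).trace = 0
  rw [M_eq u l hu, Matrix.trace_mul_comm, ← Matrix.mul_assoc, hu', Matrix.one_mul,
    Matrix.trace_diagonal]
  simp [hl]

lemma M_frob {n : ℕ} (u : Matrix (Fin n) (Fin n) ℝ) (l : Fin n → ℝ) (hu : u * uᵀ = 1) :
    ∑ i, ∑ j, M u l i j ^ 2 = ∑ i, (l i - 1) ^ 2 := by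
  have hu' : uᵀ * u = 1 := mul_eq_one_comm.1 hu
  have h1 : ∑ i, ∑ j, M u l i j ^ 2 = (M u l * (M u l)ᵀ).trace := by
    simp [Matrix.trace, Matrix.mul_apply, sq]
  have h2 : M u l * (M u l)ᵀ = u * Matrix.diagonal (fun i => (l i - 1) * (l i - 1)) * uᵀ := by
    rw [M_eq u l hu]
    simp only [Matrix.transpose_mul, Matrix.transpose_transpose, Matrix.diagonal_transpose]
    rw [← Matrix.diagonal_mul_diagonal]
    calc _ = u * Matrix.diagonal (fun i => l i - 1) * (uᵀ * u) *
          Matrix.diagonal (fun i => l i - 1) * uᵀ := by simp only [Matrix.mul_assoc]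
      _ = _ := by rw [hu']; simp only [Matrix.mul_assoc, Matrix.one_mul]
  rw [h1, h2, Matrix.trace_mul_comm, ← Matrix.mul_assoc, hu', Matrix.one_mul,
    Matrix.trace_diagonal]
  simp [sq]

def B (n : ℕ) (t : ℝ) : Set (Fin n → ℝ) :=
  {l | ((∀ i, 0 ≤ l i) ∧ ∑ i, l i = n) ∧ ∀ i, l i ≤ t}

lemma measurableSet_B (n : ℕ) (t : ℝ) : MeasurableSet (B n t) := by
  unfold B; measurability

lemma frob_le {n : ℕ} (t : ℝ) (l : Fin n → ℝ) (hl : l ∈ B n t) :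
    ∑ i, (l i - 1) ^ 2 ≤ n * t := by
  obtain ⟨⟨h0, h1⟩, h2⟩ := hl
  calc ∑ i, (l i - 1) ^ 2 ≤ ∑ i, (t * l i - 2 * l i + 1) := by
        gcongr with i
        nlinarith [h0 i, h2 i]
    _ = t * n - 2 * n + n := by
        rw [Finset.sum_add_distrib, Finset.sum_sub_distrib, ← Finset.mul_sum, ← Finset.mul_sum, h1]
        simp
    _ ≤ n * t := by nlinarith [(Nat.cast_nonneg n : (0:ℝ) ≤ n)]

noncomputable def qf {n : ℕ} (A : Matrix (Fin n) (Fin n) ℝ) (x : Fin n → ℝ) : ℝ := x ⬝ᵥ (A *ᵥ x)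

lemma qf_eq {n : ℕ} (A : Matrix (Fin n) (Fin n) ℝ) (x : Fin n → ℝ) :
    qf A x = ∑ i, ∑ j, A i j * x i * x j := by
  simp only [qf, dotProduct, Matrix.mulVec, Finset.mul_sum]
  refine Finset.sum_congr rfl fun i _ => Finset.sum_congr rfl fun j _ => by ring

lemma qf_rot {n : ℕ} (u Q : Matrix (Fin n) (Fin n) ℝ) (l : Fin n → ℝ) (x : Fin n → ℝ)
    (hQ : Q * Qᵀ = 1) : qf (M (Q * u) l) x = qf (M u l) (Qᵀ *ᵥ x) := by
  have : M (Q * u) l = Q * M u l * Qᵀ := by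
    simp only [M, Matrix.transpose_mul, Matrix.mul_sub, Matrix.sub_mul, Matrix.mul_one, hQ]
    simp only [Matrix.mul_assoc]
  rw [this, qf, qf, ← Matrix.mulVec_mulVec, ← Matrix.mulVec_mulVec, Matrix.dotProduct_mulVec,
    Matrix.mulVec_transpose]

lemma exists_rot {n : ℕ} (x y : Fin n → ℝ) (hx : x ⬝ᵥ x = 1) (hy : y ⬝ᵥ y = 1) :
    ∃ Q : Matrix (Fin n) (Fin n) ℝ, Q * Qᵀ = 1 ∧ Qᵀ *ᵥ x = y := by
  by_cases hxy : x = y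
  · exact ⟨1, by simp, by simp [hxy]⟩
  set v := x - y with hv
  have hv0 : v ⬝ᵥ v ≠ 0 := by
    rw [Ne, dotProduct_self_eq_zero, hv, sub_eq_zero]; exact hxy
  have hvx : v ⬝ᵥ v = 2 * (v ⬝ᵥ x) := by
    simp only [hv, sub_dotProduct, dotProduct_sub, hx, hy, dotProduct_comm y x]; ring
  set c := v ⬝ᵥ v with hc
  set H : Matrix (Fin n) (Fin n) ℝ := 1 - (2 / c) • Matrix.vecMulVec v v with hH
  have hHt : Hᵀ = H := by
    simp [hH, Matrix.transpose_vecMulVec]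
  refine ⟨H, ?_, ?_⟩
  · rw [hHt]
    have hvv : Matrix.vecMulVec v v * Matrix.vecMulVec v v = c • Matrix.vecMulVec v v := by
      rw [Matrix.vecMulVec_mul_vecMulVec, Matrix.vecMulVec_smul]
    rw [hH, Matrix.mul_sub, Matrix.sub_mul, Matrix.sub_mul, Matrix.smul_mul, Matrix.mul_smul,
      Matrix.smul_mul, Matrix.mul_smul, hvv]
    simp only [Matrix.mul_one, Matrix.one_mul, smul_smul]
    have : 2 / c * (2 / c * c) = 2 / c + 2 / c := by field_simp; norm_num
    rw [this, add_smul]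
    abel
  · rw [hHt, hH, Matrix.sub_mulVec, Matrix.smul_mulVec, Matrix.vecMulVec_mulVec]
    ext i
    have h1 : 2 / c * (v ⬝ᵥ x) = 1 := by rw [div_mul_eq_mul_div, ← hvx, div_self hv0]
    simp only [Matrix.one_mulVec, Pi.sub_apply, Pi.smul_apply, MulOpposite.smul_eq_mul_unop,
      MulOpposite.unop_op, smul_eq_mul]
    have : v i = x i - y i := rfl
    linear_combination (-v i) * h1 - this

noncomputable def F {n : ℕ} (t : ℝ) (x : Fin n → ℝ)
    (z : Matrix (Fin n) (Fin n) ℝ × (Fin n → ℝ)) : ENNReal :=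
  (B n t).indicator (fun _ => ENNReal.ofReal ((qf (M z.1 z.2) x) ^ 8)) z.2

lemma measurable_entry {n : ℕ} (i j : Fin n) :
    Measurable (fun u : Matrix (Fin n) (Fin n) ℝ => u i j) :=
  (measurable_pi_apply j).comp (measurable_pi_apply i)

lemma measurable_matrix {α : Type*} [MeasurableSpace α] {n : ℕ}
    (f : α → Matrix (Fin n) (Fin n) ℝ) (h : ∀ i j, Measurable fun a => f a i j) :
    Measurable f :=
  measurable_pi_iff.2 fun i => measurable_pi_iff.2 fun j => h i j

lemma measurable_F {n : ℕ} (t : ℝ) (x : Fin n → ℝ) : Measurable (F t x) := by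
  have e : F t x = (Prod.snd ⁻¹' (B n t)).indicator
      (fun z => ENNReal.ofReal ((qf (M z.1 z.2) x) ^ 8)) := by
    ext z; rfl
  rw [e]
  refine Measurable.indicator ?_ (measurable_snd (measurableSet_B n t))
  apply Measurable.ennreal_ofReal
  apply Measurable.pow_const
  simp only [qf_eq, M_apply]
  have hm : ∀ i j, Measurable fun z : Matrix (Fin n) (Fin n) ℝ × (Fin n → ℝ) => z.1 i j :=
    fun i j => (measurable_entry i j).comp measurable_fst
  refine Finset.measurable_sum _ fun i _ => Finset.measurable_sum _ fun j _ => ?_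
  refine ((Measurable.sub_const (Finset.measurable_sum _ fun k _ => ?_) _).mul_const _).mul_const _
  exact ((hm i k).mul ((measurable_pi_apply k).comp measurable_snd)).mul (hm j k)

lemma F_rot {n : ℕ} (t : ℝ) (π₁ : Measure (Matrix (Fin n) (Fin n) ℝ)) (π₂ : Measure (Fin n → ℝ))
    [IsProbabilityMeasure π₁] [IsProbabilityMeasure π₂]
    (hinv : ∀ Q : Matrix (Fin n) (Fin n) ℝ, Q * Qᵀ = 1 → Measure.map (fun A => Q * A) π₁ = π₁)
    (x y : Fin n → ℝ) (hx : x ⬝ᵥ x = 1) (hy : y ⬝ᵥ y = 1) :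
    ∫⁻ z, F t x z ∂(π₁.prod π₂) = ∫⁻ z, F t y z ∂(π₁.prod π₂) := by
  obtain ⟨Q, hQ, hQx⟩ := exists_rot x y hx hy
  have hQm : Measurable (fun A : Matrix (Fin n) (Fin n) ℝ => Q * A) := by
    apply measurable_matrix
    intro i j
    simp only [Matrix.mul_apply]
    exact Finset.measurable_sum _ fun k _ => (measurable_entry k j).const_mul _
  have hmap : Measure.map (Prod.map (fun A => Q * A) id) (π₁.prod π₂) = π₁.prod π₂ := by
    rw [← Measure.map_prod_map _ _ hQm measurable_id, hinv Q hQ, Measure.map_id]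
  conv_lhs => rw [← hmap]
  rw [lintegral_map (measurable_F t x) (hQm.prodMap measurable_id)]
  refine lintegral_congr fun z => ?_
  simp only [F, Prod.map_fst, Prod.map_snd, id, qf_rot _ _ _ _ hQ, hQx]

lemma F_avg {n : ℕ} (hn : 0 < n) (t : ℝ) (u : Matrix (Fin n) (Fin n) ℝ) (l : Fin n → ℝ)
    (hu : u * uᵀ = 1) :
    ∑ s : Fin n → Bool, F t (fun i => sgn (s i) / √n) (u, l) ≤
      2 ^ n * ENNReal.ofReal (9 ^ 30 * 16 * t ^ 4 / n ^ 4) := by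
  by_cases hl : l ∈ B n t
  · have hn' : (0 : ℝ) < n := by exact_mod_cast hn
    simp only [F, Set.indicator_of_mem hl]
    rw [← ENNReal.ofReal_sum_of_nonneg (fun s _ => by positivity)]
    have h2 : (2 : ENNReal) ^ n = ENNReal.ofReal (2 ^ n) := by
      rw [ENNReal.ofReal_pow (by norm_num)]; simp
    rw [h2, ← ENNReal.ofReal_mul (by positivity)]
    apply ENNReal.ofReal_le_ofReal
    have key := quad_eighth n (M u l) (M_trace u l hu hl.1.2) (n * t)
      ((M_frob u l hu).le.trans (frob_le t l hl))
    unfold E at key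
    rw [div_le_iff₀ (by positivity)] at key
    have hq : ∀ s : Fin n → Bool, qf (M u l) (fun i => sgn (s i) / √n) ^ 8 =
        (∑ i, ∑ j, M u l i j * sgn (s i) * sgn (s j)) ^ 8 / n ^ 8 := by
      intro s
      rw [← div_pow, qf_eq, Finset.sum_div]
      simp only [Finset.sum_div]
      congr 1
      refine Finset.sum_congr rfl fun i _ => Finset.sum_congr rfl fun j _ => ?_
      have : √(n:ℝ) * √n = n := Real.mul_self_sqrt hn'.le
      calc _ = M u l i j * sgn (s i) * sgn (s j) / (√(n:ℝ) * √n) := by field_simp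
        _ = _ := by rw [this]
    simp only [hq]
    rw [← Finset.sum_div, div_le_iff₀ (by positivity)]
    refine key.trans (le_of_eq ?_)
    field_simp
    ring
  · simp [F, hl]

lemma F_bound {n : ℕ} (hn : 0 < n) (t : ℝ) (π₁ : Measure (Matrix (Fin n) (Fin n) ℝ))
    (π₂ : Measure (Fin n → ℝ))
    [IsProbabilityMeasure π₁] [IsProbabilityMeasure π₂]
    (hinv : ∀ Q : Matrix (Fin n) (Fin n) ℝ, Q * Qᵀ = 1 → Measure.map (fun A => Q * A) π₁ = π₁)
    (horth : ∀ᵐ z ∂(π₁.prod π₂), z.1 * z.1ᵀ = 1)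
    (x : Fin n → ℝ) (hx : x ⬝ᵥ x = 1) :
    ∫⁻ z, F t x z ∂(π₁.prod π₂) ≤ ENNReal.ofReal (9 ^ 30 * 16 * t ^ 4 / n ^ 4) := by
  have hn' : (0 : ℝ) < n := by exact_mod_cast hn
  have hs : ∀ s : Fin n → Bool, (fun i => sgn (s i) / √n) ⬝ᵥ (fun i => sgn (s i) / √n) = 1 := by
    intro s
    have : √(n:ℝ) * √n = n := Real.mul_self_sqrt hn'.le
    simp [dotProduct, div_mul_div_comm, sgn_sq, this, hn'.ne']
  have h1 : (2 : ENNReal) ^ n * ∫⁻ z, F t x z ∂(π₁.prod π₂) =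
      ∫⁻ z, ∑ s : Fin n → Bool, F t (fun i => sgn (s i) / √n) z ∂(π₁.prod π₂) := by
    rw [lintegral_finsetSum _ (fun s _ => measurable_F _ _)]
    simp only [F_rot t π₁ π₂ hinv _ x (hs _) hx]
    simp
  have h2 : ∫⁻ z, ∑ s : Fin n → Bool, F t (fun i => sgn (s i) / √n) z ∂(π₁.prod π₂) ≤
      2 ^ n * ENNReal.ofReal (9 ^ 30 * 16 * t ^ 4 / n ^ 4) := by
    calc _ ≤ ∫⁻ z, 2 ^ n * ENNReal.ofReal (9 ^ 30 * 16 * t ^ 4 / n ^ 4) ∂(π₁.prod π₂) :=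
          lintegral_mono_ae (horth.mono fun z hz => F_avg hn t z.1 z.2 hz)
      _ = _ := by simp
  rw [← h1] at h2
  exact (ENNReal.mul_le_mul_iff_right (by simp) (by simp)).1 h2

/-- Test vectors for polarization. -/
noncomputable def tv {n : ℕ} (j k : Fin n) : Fin n → ℝ :=
  if j = k then Pi.single j 1 else (√2)⁻¹ • (Pi.single j 1 + Pi.single k 1)

lemma tv_unit {n : ℕ} (j k : Fin n) : tv j k ⬝ᵥ tv j k = 1 := by
  unfold tv
  have h2 : (√2)⁻¹ * (√2)⁻¹ = (1/2 : ℝ) := by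
    rw [← mul_inv, Real.mul_self_sqrt (by norm_num)]; norm_num
  split_ifs with h
  · simp
  · simp only [smul_dotProduct, dotProduct_smul, smul_eq_mul, add_dotProduct, dotProduct_add,
      single_dotProduct]
    simp [h, Ne.symm h]
    linear_combination 2 * h2

lemma M_symm {n : ℕ} (u : Matrix (Fin n) (Fin n) ℝ) (l : Fin n → ℝ) (j k : Fin n) :
    M u l j k = M u l k j := by
  rw [M_apply, M_apply, Matrix.one_apply, Matrix.one_apply]
  simp only [eq_comm (a := j)]
  congr 1
  exact Finset.sum_congr rfl fun i _ => by ring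

lemma polar {n : ℕ} (u : Matrix (Fin n) (Fin n) ℝ) (l : Fin n → ℝ) (ε : ℝ)
    (j k : Fin n) (h : ε < |M u l j k|) : ∃ j k, ε / 2 < |qf (M u l) (tv j k)| := by
  by_contra! hc
  have hd : ∀ j, qf (M u l) (tv j j) = M u l j j := by
    intro j; simp [qf, tv]
  have h1 := hc j j
  have h2 := hc k k
  have h3 := hc j k
  rw [hd] at h1 h2
  by_cases hjk : j = k
  · subst hjk; linarith [abs_nonneg (M u l j j)]
  · have e : qf (M u l) (tv j k) = M u l j k + (M u l j j + M u l k k) / 2 := by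
      have h2 : (√2)⁻¹ * (√2)⁻¹ = (1/2 : ℝ) := by
        rw [← mul_inv, Real.mul_self_sqrt (by norm_num)]; norm_num
      simp only [qf, tv, hjk, if_false, Matrix.mulVec_smul, smul_dotProduct, dotProduct_smul,
        smul_eq_mul, Matrix.mulVec_add, add_dotProduct, dotProduct_add]
      simp
      rw [M_symm u l k j]
      linear_combination (M u l j j + 2 * M u l j k + M u l k k) * h2
    rw [e] at h3
    rw [abs_le] at h1 h2 h3
    rw [lt_abs] at h
    rcases h with h | h <;> linarith

lemma main_bound {Ω : Type} [MeasurableSpace Ω] (P : Measure Ω) [IsProbabilityMeasure P]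
    (n : ℕ) (hn : 2 ≤ n) (lam : Ω → (Fin n → ℝ)) (hlamMeas : Measurable lam)
    (U : Ω → Matrix (Fin n) (Fin n) ℝ) (hUMeas : Measurable U)
    (hlamLaw : Measure.map lam P = simplexUniform n)
    (hUorth : ∀ᵐ ω ∂P, U ω * (U ω)ᵀ = 1)
    (hUHaar : ∀ Q : Matrix (Fin n) (Fin n) ℝ, Q * Qᵀ = 1 →
      Measure.map (fun A => Q * A) (Measure.map U P) = Measure.map U P)
    (hIndep : IndepFun U lam P) (ε : ℝ) (hε : 0 < ε) (t : ℝ) (h0 : 0 ≤ t) (ht : t < n) :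
    P {ω | ∃ j k : Fin n, ε < |(U ω * Matrix.diagonal (lam ω) * (U ω)ᵀ) j k -
            (1 : Matrix (Fin n) (Fin n) ℝ) j k|} ≤
      ENNReal.ofReal (n * Real.exp (- t / 2) +
        n ^ 2 * ((9 ^ 30 * 16 * t ^ 4 / n ^ 4) / (ε / 2) ^ 8)) := by
  have hn' : (0 : ℝ) < n := by exact_mod_cast (by omega : 0 < n)
  have i1 : IsProbabilityMeasure (Measure.map U P) :=
    Measure.isProbabilityMeasure_map hUMeas.aemeasurable
  have i2 : IsProbabilityMeasure (Measure.map lam P) :=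
    Measure.isProbabilityMeasure_map hlamMeas.aemeasurable
  have hXm : Measurable (fun ω => (U ω, lam ω)) := hUMeas.prodMk hlamMeas
  have hX : Measure.map (fun ω => (U ω, lam ω)) P = (Measure.map U P).prod (Measure.map lam P) :=
    (indepFun_iff_map_prod_eq_prod_map_map hUMeas.aemeasurable hlamMeas.aemeasurable).1 hIndep
  have hmo : MeasurableSet {z : Matrix (Fin n) (Fin n) ℝ × (Fin n → ℝ) | z.1 * z.1ᵀ = 1} := by
    have : {z : Matrix (Fin n) (Fin n) ℝ × (Fin n → ℝ) | z.1 * z.1ᵀ = 1} =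
        ⋂ i, ⋂ j, {z | ∑ k, z.1 i k * z.1 j k = (1 : Matrix (Fin n) (Fin n) ℝ) i j} := by
      ext z
      simp [← Matrix.ext_iff, Matrix.mul_apply]
    rw [this]
    refine MeasurableSet.iInter fun i => MeasurableSet.iInter fun j => ?_
    refine measurableSet_eq_fun (Finset.measurable_sum _ fun k _ => ?_) measurable_const
    exact ((measurable_entry i k).comp measurable_fst).mul
      ((measurable_entry j k).comp measurable_fst)
  have horth : ∀ᵐ z ∂((Measure.map U P).prod (Measure.map lam P)), z.1 * z.1ᵀ = 1 := by
    rw [← hX, ae_map_iff hXm.aemeasurable hmo]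
    exact hUorth
  have hev : ∀ j k : Fin n, P {ω | ENNReal.ofReal ((ε / 2) ^ 8) ≤ F t (tv j k) (U ω, lam ω)} ≤
      ENNReal.ofReal ((9 ^ 30 * 16 * t ^ 4 / n ^ 4) / (ε / 2) ^ 8) := by
    intro j k
    rw [ENNReal.ofReal_div_of_pos (by positivity)]
    refine (meas_ge_le_lintegral_div ((measurable_F t _).comp hXm).aemeasurable ?_ ?_).trans ?_
    · simp; positivity
    · simp
    · gcongr
      have := F_bound (by omega) t _ _ hUHaar horth (tv j k) (tv_unit j k)
      rw [← hX, lintegral_map (measurable_F t _) hXm] at this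
      exact this
  have hB : P {ω | lam ω ∉ B n t} ≤ ENNReal.ofReal (n * Real.exp (- t / 2)) := by
    have := simplex_max n hn t h0 ht
    rw [← hlamLaw, Measure.map_apply hlamMeas] at this
    · exact this
    · exact (measurableSet_B n t).compl
  have hsub : {ω | ∃ j k : Fin n, ε < |(U ω * Matrix.diagonal (lam ω) * (U ω)ᵀ) j k -
            (1 : Matrix (Fin n) (Fin n) ℝ) j k|} ⊆ {ω | lam ω ∉ B n t} ∪
      ⋃ j, ⋃ k, {ω | ENNReal.ofReal ((ε / 2) ^ 8) ≤ F t (tv j k) (U ω, lam ω)} := by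
    rintro ω ⟨j, k, h⟩
    by_cases hl : lam ω ∈ B n t
    · right
      obtain ⟨j', k', h'⟩ := polar (U ω) (lam ω) ε j k h
      refine Set.mem_iUnion.2 ⟨j', Set.mem_iUnion.2 ⟨k', ?_⟩⟩
      change _ ≤ F _ _ _
      simp only [F, Set.indicator_of_mem hl]
      apply ENNReal.ofReal_le_ofReal
      rw [← (by decide : Even 8).pow_abs (qf _ _)]
      gcongr
    · left; exact hl
  calc _ ≤ _ := measure_mono hsub
    _ ≤ _ := measure_union_le _ _
    _ ≤ ENNReal.ofReal (n * Real.exp (- t / 2)) + ∑ j : Fin n, ∑ k : Fin n,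
        ENNReal.ofReal ((9 ^ 30 * 16 * t ^ 4 / n ^ 4) / (ε / 2) ^ 8) := by
      gcongr
      refine (measure_iUnion_fintype_le _ _).trans ?_
      gcongr with j
      refine (measure_iUnion_fintype_le _ _).trans ?_
      gcongr with k
      exact hev j k
    _ = _ := by
      rw [ENNReal.ofReal_add (by positivity) (by positivity),
        ENNReal.ofReal_mul (p := (n:ℝ)^2) (by positivity), ENNReal.ofReal_pow hn'.le]
      simp
      ring

lemma lim_bound (c : ℝ) : Filter.Tendsto (fun n : ℕ => (n : ℝ) * Real.exp (- (4 * Real.log n) / 2) +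
        n ^ 2 * ((9 ^ 30 * 16 * (4 * Real.log n) ^ 4 / n ^ 4) / c)) Filter.atTop (nhds 0) := by
  have hl : Filter.Tendsto (fun x : ℝ => Real.log x ^ 4 / x ^ (2:ℝ)) Filter.atTop (nhds 0) := by
    have := (isLittleO_log_rpow_rpow_atTop (s := 2) 4 (by norm_num)).tendsto_div_nhds_zero
    refine this.congr fun x => ?_
    norm_cast
  have h1 : Filter.Tendsto (fun n : ℕ => ((n : ℝ))⁻¹ +
      (9 ^ 30 * 16 * 4 ^ 4 / c) * (Real.log n ^ 4 / (n:ℝ) ^ (2:ℝ))) Filter.atTop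
        (nhds (0 + (9 ^ 30 * 16 * 4 ^ 4 / c) * 0)) :=
    tendsto_inv_atTop_nhds_zero_nat.add
      ((hl.comp tendsto_natCast_atTop_atTop).const_mul _)
  rw [mul_zero, add_zero] at h1
  refine h1.congr' ?_
  filter_upwards [Filter.eventually_gt_atTop 0] with n hn
  have hn' : (0 : ℝ) < n := by exact_mod_cast hn
  have : Real.exp (- (4 * Real.log n) / 2) = ((n : ℝ) ^ 2)⁻¹ := by
    rw [show - (4 * Real.log n) / 2 = -(((2:ℕ):ℝ) * Real.log n) by push_cast; ring, Real.exp_neg,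
      Real.exp_nat_mul, Real.exp_log hn']
  rw [this, Real.rpow_two]
  by_cases hc : c = 0
  · subst hc; simp; field_simp
  field_simp

end KO

/-- For each `n`, let `λ⁽ⁿ⁾` be uniform on the scaled simplex `𝕊^n` and `U⁽ⁿ⁾`
be Haar-distributed on the orthogonal group `O(n)` (its law is supported on
orthogonal matrices and is left-invariant under multiplication by orthogonal
matrices, which characterizes the Haar probability measure), independent of
`λ⁽ⁿ⁾`.  Then `Σ^{ko,n} = U⁽ⁿ⁾ diag(λ⁽ⁿ⁾) (U⁽ⁿ⁾)ᵀ` converges to the identity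
in probability as `n → ∞`, uniformly over the entries. -/
theorem stmt_16
    (Ω : ℕ → Type) (instΩ : ∀ n, MeasurableSpace (Ω n))
    (P : ∀ n, Measure (Ω n)) (hP : ∀ n, IsProbabilityMeasure (P n))
    (lam : ∀ n, Ω n → (Fin n → ℝ)) (hlamMeas : ∀ n, Measurable (lam n))
    (U : ∀ n, Ω n → Matrix (Fin n) (Fin n) ℝ) (hUMeas : ∀ n, Measurable (U n))
    (hlamLaw : ∀ n, 2 ≤ n → Measure.map (lam n) (P n) = simplexUniform n)
    (hUorth : ∀ n, ∀ᵐ ω ∂(P n), U n ω * (U n ω)ᵀ = 1)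
    (hUHaar : ∀ n, ∀ Q : Matrix (Fin n) (Fin n) ℝ, Q * Qᵀ = 1 →
      Measure.map (fun A => Q * A) (Measure.map (U n) (P n)) =
        Measure.map (U n) (P n))
    (hIndep : ∀ n, IndepFun (U n) (lam n) (P n)) :
    ∀ ε : ℝ, 0 < ε →
      Filter.Tendsto
        (fun n => (P n) {ω | ∃ j k : Fin n,
          ε < |(U n ω * Matrix.diagonal (lam n ω) * (U n ω)ᵀ) j k -
            (1 : Matrix (Fin n) (Fin n) ℝ) j k|})
        Filter.atTop (nhds 0) := by
  intro ε hε
  have hlim := ENNReal.tendsto_ofReal (KO.lim_bound ((ε / 2) ^ 8))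
  rw [ENNReal.ofReal_zero] at hlim
  have hlog : ∀ᶠ n : ℕ in Filter.atTop, 4 * Real.log (n : ℝ) < n := by
    have h := (Real.isLittleO_log_id_atTop.comp_tendsto
      (tendsto_natCast_atTop_atTop (R := ℝ))).bound (show (0 : ℝ) < 1 / 5 by norm_num)
    filter_upwards [h, Filter.eventually_gt_atTop 0] with n hn hn0
    have hn' : (0 : ℝ) < n := by exact_mod_cast hn0
    simp only [Function.comp, id, Real.norm_eq_abs, abs_of_pos hn'] at hn
    linarith [le_abs_self (Real.log n)]
  refine tendsto_of_tendsto_of_tendsto_of_le_of_le' tendsto_const_nhds hlim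
    (Filter.Eventually.of_forall fun _ => bot_le) ?_
  filter_upwards [hlog, Filter.eventually_ge_atTop 2] with n hn1 hn2
  have := hP n
  have hn' : (1 : ℝ) ≤ n := by exact_mod_cast (by omega : 1 ≤ n)
  exact KO.main_bound (P n) n hn2 (lam n) (hlamMeas n) (U n) (hUMeas n) (hlamLaw n hn2)
    (hUorth n) (hUHaar n) (hIndep n) ε hε (4 * Real.log n)
    (mul_nonneg (by norm_num) (Real.log_nonneg hn')) hn1
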